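/- Let Φ(ρ) = p₁ρ + Σ_{i=2}^N pᵢ Dᵢ ρ Dᵢ* be a general phase damping channel on 2×2 complex matrices, where Dᵢ = diag(1, e^{iθᵢ}), all pᵢ > 0 and Σ pᵢ = 1, and let e₀, e₁ denote the standard basis vectors of ℂ². Then for every unit vector φ = (a, b) in ℂ²: F(Φ(e₀e₀*), Φ(φφ*)) = |a| = F(e₀e₀*, φφ*), F(Φ(e₁e₁*), Φ(φφ*)) = |b| = F(e₁e₁*, φφ*), and F(Φ(e₀e₀*), Φ(e₁e₁*)) = 0; consequently the set {e₀e₀*, e₁e₁*, φφ*} is preserved by Φ (the fidelity between any two of its members is unchanged by Φ). -/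

import Mathlib

open Matrix ComplexOrder

/-- The positive semidefinite square root of a positive semidefinite matrix
(Mathlib's former `Matrix.PosSemidef.sqrt`, since removed). -/
noncomputable def Matrix.PosSemidef.sqrt {n 𝕜 : Type*} [Fintype n] [RCLike 𝕜] [DecidableEq n]
    {A : Matrix n n 𝕜} (hA : A.PosSemidef) : Matrix n n 𝕜 :=
  hA.1.eigenvectorUnitary.1 * diagonal ((↑) ∘ Real.sqrt ∘ hA.1.eigenvalues) *
    (star hA.1.eigenvectorUnitary : Matrix n n 𝕜)

/-- The positive semidefinite square root of a matrix (junk value `0` if not PSD). -/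
noncomputable def psdSqrt {n : Type*} [Fintype n] [DecidableEq n]
    (A : Matrix n n ℂ) : Matrix n n ℂ :=
  letI := Classical.propDecidable A.PosSemidef
  if h : A.PosSemidef then h.sqrt else 0

/-- Fidelity `F(ρ,σ) = tr √(√σ ρ √σ)`. -/
noncomputable def fid {n : Type*} [Fintype n] [DecidableEq n]
    (ρ σ : Matrix n n ℂ) : ℝ :=
  (psdSqrt (psdSqrt σ * ρ * psdSqrt σ)).trace.re

/-- Trace norm `‖M‖₁ = tr √(M* M)`. -/
noncomputable def traceNorm {n : Type*} [Fintype n] [DecidableEq n]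
    (M : Matrix n n ℂ) : ℝ :=
  (psdSqrt (Mᴴ * M)).trace.re

/-- Inner product on `ℂ^ι`, conjugate-linear in the first argument. -/
noncomputable def cinner {ι : Type*} [Fintype ι] (x y : ι → ℂ) : ℂ := star x ⬝ᵥ y

/-- Rank-one density operator `φφ*` of a vector `φ`. -/
noncomputable def outer {ι : Type*} [Fintype ι] (φ : ι → ℂ) : Matrix ι ι ℂ :=
  vecMulVec φ (star φ)

open scoped MatrixOrder Matrix.Norms.L2Operator in
theorem aux_unique {n : Type*} [Fintype n] [DecidableEq n] {B C : Matrix n n ℂ}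
    (hB : B.PosSemidef) (hC : C.PosSemidef) (h : B * B = C * C) : B = C :=
  (CFC.mul_self_eq_mul_self_iff B C hB.nonneg hC.nonneg).1 h

theorem aux_sqrt_psd {n : Type*} [Fintype n] [DecidableEq n] {A : Matrix n n ℂ}
    (hA : A.PosSemidef) : hA.sqrt.PosSemidef := by
  unfold Matrix.PosSemidef.sqrt
  refine Matrix.PosSemidef.mul_mul_conjTranspose_same (Matrix.PosSemidef.diagonal ?_) _
  intro i
  simp [Real.sqrt_nonneg]

theorem aux_sqrt_mul {n : Type*} [Fintype n] [DecidableEq n] {A : Matrix n n ℂ}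
    (hA : A.PosSemidef) : hA.sqrt * hA.sqrt = A := by
  have hU : (star hA.1.eigenvectorUnitary : Matrix n n ℂ) * hA.1.eigenvectorUnitary.1 = 1 :=
    (Matrix.mem_unitaryGroup_iff').1 hA.1.eigenvectorUnitary.2
  have hs := hA.1.spectral_theorem
  rw [Unitary.conjStarAlgAut_apply] at hs
  conv_rhs => rw [hs]
  unfold Matrix.PosSemidef.sqrt
  have hd : (diagonal ((↑) ∘ Real.sqrt ∘ hA.1.eigenvalues) : Matrix n n ℂ) *
      diagonal ((↑) ∘ Real.sqrt ∘ hA.1.eigenvalues)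
      = diagonal (RCLike.ofReal ∘ hA.1.eigenvalues) := by
    rw [diagonal_mul_diagonal]
    congr 1
    funext i
    have := Real.mul_self_sqrt (hA.eigenvalues_nonneg i)
    have h2 := congrArg (fun x : ℝ => (x : ℂ)) this
    simp only [Complex.ofReal_mul] at h2
    exact h2
  rw [← hd]
  generalize (diagonal ((↑) ∘ Real.sqrt ∘ hA.1.eigenvalues) : Matrix n n ℂ) = D
  simp only [Matrix.mul_assoc]
  rw [← Matrix.mul_assoc (star _ : Matrix n n ℂ) hA.1.eigenvectorUnitary.1, hU, Matrix.one_mul]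

theorem psdSqrt_psd {n : Type*} [Fintype n] [DecidableEq n] (A : Matrix n n ℂ) :
    (psdSqrt A).PosSemidef := by
  unfold psdSqrt
  split_ifs with h
  · exact aux_sqrt_psd h
  · exact Matrix.PosSemidef.zero

theorem psdSqrt_mul {n : Type*} [Fintype n] [DecidableEq n] {A : Matrix n n ℂ}
    (hA : A.PosSemidef) : psdSqrt A * psdSqrt A = A := by
  unfold psdSqrt
  rw [dif_pos hA]
  exact aux_sqrt_mul hA

theorem psdSqrt_eq {n : Type*} [Fintype n] [DecidableEq n] {A B : Matrix n n ℂ}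
    (hB : B.PosSemidef) (h : B * B = A) : psdSqrt A = B := by
  have hA : A.PosSemidef := by
    have := posSemidef_conjTranspose_mul_self B
    rwa [hB.1.eq, h] at this
  exact aux_unique (psdSqrt_psd A) hB ((psdSqrt_mul hA).trans h.symm)

theorem outer_psd {n : Type*} [Fintype n] (w : n → ℂ) : (outer w).PosSemidef :=
  posSemidef_vecMulVec_self_star w

theorem outer_mul_outer {n : Type*} [Fintype n] (w : n → ℂ) :
    outer w * outer w = (star w ⬝ᵥ w) • outer w := by
  unfold outer
  rw [vecMulVec_mul_vecMulVec]
  ext i j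
  simp [vecMulVec_apply]
  ring

theorem aux_c {n : Type*} [Fintype n] (w : n → ℂ) :
    0 ≤ (star w ⬝ᵥ w).re ∧ star w ⬝ᵥ w = ((star w ⬝ᵥ w).re : ℂ) := by
  have := Complex.nonneg_iff.1 (dotProduct_self_star_nonneg w)
  rw [dotProduct_comm w (star w)] at this
  exact ⟨this.1, Complex.ext rfl (by simp [← this.2])⟩

theorem trace_psdSqrt_outer {n : Type*} [Fintype n] [DecidableEq n] (w : n → ℂ) :
    (psdSqrt (outer w)).trace.re = Real.sqrt (star w ⬝ᵥ w).re := by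
  obtain ⟨h0, h1⟩ := aux_c w
  have hm := outer_mul_outer w
  have ht : (outer w).trace = star w ⬝ᵥ w := by
    unfold outer; rw [trace_vecMulVec, dotProduct_comm]
  generalize (star w ⬝ᵥ w).re = c at *
  rcases h0.eq_or_lt with hc | hc
  · subst hc
    have hw : w = 0 := by
      rw [Complex.ofReal_zero] at h1
      exact dotProduct_star_self_eq_zero.1 h1
    rw [psdSqrt_eq (B := 0) Matrix.PosSemidef.zero (by ext; simp [hw, outer, vecMulVec_apply])]
    simp
  · have hs : (Real.sqrt c) ≠ 0 := (Real.sqrt_pos.2 hc).ne'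
    have hss : Real.sqrt c * Real.sqrt c = c := Real.mul_self_sqrt hc.le
    have hsc : ((Real.sqrt c : ℝ) : ℂ) ≠ 0 := by exact_mod_cast hs
    have hssc : ((Real.sqrt c : ℝ) : ℂ) * ((Real.sqrt c : ℝ) : ℂ) = c := by exact_mod_cast hss
    rw [psdSqrt_eq (B := (((Real.sqrt c)⁻¹ : ℝ) : ℂ) • outer w)]
    · rw [trace_smul, ht, h1, smul_eq_mul, ← Complex.ofReal_mul, Complex.ofReal_re]
      field_simp
      nlinarith
    · refine (outer_psd w).smul ?_
      exact_mod_cast inv_nonneg.2 (Real.sqrt_nonneg c)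
    · rw [smul_mul_smul_comm, hm, h1, smul_smul, ← hssc]
      push_cast
      field_simp
      simp

theorem fid_outer_left {n : Type*} [Fintype n] [DecidableEq n] (v : n → ℂ) {σ : Matrix n n ℂ}
    (hσ : σ.PosSemidef) : fid (outer v) σ = Real.sqrt (star v ⬝ᵥ (σ *ᵥ v)).re := by
  have hS := psdSqrt_psd σ
  have hSS := psdSqrt_mul hσ
  unfold fid
  generalize psdSqrt σ = S at *
  have : S * outer v * S = outer (S *ᵥ v) := by
    unfold outer
    rw [mul_vecMulVec, vecMulVec_mul, star_mulVec, hS.1.eq]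
  rw [this, trace_psdSqrt_outer, star_mulVec, hS.1.eq, ← dotProduct_mulVec, mulVec_mulVec, hSS]

theorem fid_outer_right {n : Type*} [Fintype n] [DecidableEq n] (v : n → ℂ) {ρ : Matrix n n ℂ}
    (hρ : ρ.PosSemidef) (hv : star v ⬝ᵥ v = 1) :
    fid ρ (outer v) = Real.sqrt (star v ⬝ᵥ (ρ *ᵥ v)).re := by
  have h1 : psdSqrt (outer v) = outer v :=
    psdSqrt_eq (outer_psd v) (by rw [outer_mul_outer, hv, one_smul])
  have hq := Complex.nonneg_iff.1 (hρ.dotProduct_mulVec_nonneg v)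
  have hq' : star v ⬝ᵥ (ρ *ᵥ v) = ((star v ⬝ᵥ (ρ *ᵥ v)).re : ℂ) :=
    Complex.ext rfl (by simp [← hq.2])
  have h2 : outer v * ρ * outer v = (star v ⬝ᵥ (ρ *ᵥ v)) • outer v := by
    unfold outer
    rw [Matrix.mul_assoc, mul_vecMulVec, vecMulVec_mul_vecMulVec]
    ext i j
    simp [vecMulVec_apply]
    ring
  unfold fid
  rw [h1, h2]
  generalize (star v ⬝ᵥ (ρ *ᵥ v)).re = q at *
  rw [hq']
  have hss : ((Real.sqrt q : ℝ) : ℂ) * ((Real.sqrt q : ℝ) : ℂ) = q := by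
    exact_mod_cast Real.mul_self_sqrt hq.1
  have h3 : (q : ℂ) • outer v = outer (((Real.sqrt q : ℝ) : ℂ) • v) := by
    ext i j
    simp only [outer, vecMulVec_apply, Matrix.smul_apply, smul_eq_mul, Pi.smul_apply, Pi.star_apply,
      star_mul', Complex.star_def, Complex.conj_ofReal]
    rw [← hss]; ring
  rw [h3, trace_psdSqrt_outer, star_smul, smul_dotProduct, dotProduct_smul, hv, smul_eq_mul,
    smul_eq_mul, mul_one, Complex.star_def, Complex.conj_ofReal, hss, Complex.ofReal_re]

theorem fid_self {n : Type*} [Fintype n] [DecidableEq n] {ρ : Matrix n n ℂ}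
    (hρ : ρ.PosSemidef) : fid ρ ρ = ρ.trace.re := by
  unfold fid
  rw [psdSqrt_eq (A := psdSqrt ρ * ρ * psdSqrt ρ) hρ]
  have h := psdSqrt_mul hρ
  generalize psdSqrt ρ = S at *
  rw [← h]
  simp only [Matrix.mul_assoc]

theorem stmt17 (N : ℕ) (hN : 0 < N)
    (p : Fin N → ℝ) (hp : ∀ i, 0 < p i) (hpsum : ∑ i, p i = 1)
    (θ : Fin N → ℝ) (hθ0 : θ ⟨0, hN⟩ = 0)
    (Φ : Matrix (Fin 2) (Fin 2) ℂ → Matrix (Fin 2) (Fin 2) ℂ)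
    (hΦ : ∀ ρ, Φ ρ = ∑ i, (p i : ℂ) •
      (Matrix.diagonal ![1, Complex.exp (θ i * Complex.I)] * ρ *
        (Matrix.diagonal ![1, Complex.exp (θ i * Complex.I)])ᴴ))
    (φ : Fin 2 → ℂ) (hφ : cinner φ φ = 1) :
    fid (Φ (outer ![1, 0])) (Φ (outer φ)) = ‖φ 0‖ ∧
      fid (outer ![1, 0]) (outer φ) = ‖φ 0‖ ∧
      fid (Φ (outer ![0, 1])) (Φ (outer φ)) = ‖φ 1‖ ∧
      fid (outer ![0, 1]) (outer φ) = ‖φ 1‖ ∧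
      fid (Φ (outer ![1, 0])) (Φ (outer ![0, 1])) = 0 ∧
      (∀ ρ ∈ ({outer ![1, 0], outer ![0, 1], outer φ} : Set (Matrix (Fin 2) (Fin 2) ℂ)),
        ∀ σ ∈ ({outer ![1, 0], outer ![0, 1], outer φ} : Set (Matrix (Fin 2) (Fin 2) ℂ)),
          fid (Φ ρ) (Φ σ) = fid ρ σ) := by
  have hv : star φ ⬝ᵥ φ = 1 := hφ
  have hv2 := hv
  simp only [dotProduct, Fin.sum_univ_two, Pi.star_apply] at hv2
  have hpc : ∑ i, (p i : ℂ) = 1 := by exact_mod_cast congrArg (fun x : ℝ => (x : ℂ)) hpsum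
  have hexp : ∀ i, Complex.exp (θ i * Complex.I) * star (Complex.exp (θ i * Complex.I)) = 1 := by
    intro i
    rw [Complex.star_def, Complex.mul_conj, Complex.normSq_eq_norm_sq,
      Complex.norm_exp_ofReal_mul_I]
    simp
  have hent : ∀ ρ, Φ ρ 0 0 = ρ 0 0 ∧ Φ ρ 1 1 = ρ 1 1 := by
    intro ρ
    constructor
    · rw [hΦ, Matrix.sum_apply]
      calc _ = ∑ i, (p i : ℂ) * ρ 0 0 := by
            refine Finset.sum_congr rfl fun i _ => ?_
            simp [diagonal_conjTranspose, diagonal_mul, mul_diagonal]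
        _ = _ := by rw [← Finset.sum_mul, hpc, one_mul]
    · rw [hΦ, Matrix.sum_apply]
      calc _ = ∑ i, (p i : ℂ) * ρ 1 1 := by
            refine Finset.sum_congr rfl fun i _ => ?_
            rw [Matrix.smul_apply, diagonal_conjTranspose, mul_diagonal, diagonal_mul, smul_eq_mul]
            congr 1
            have := hexp i
            simp only [cons_val_one, cons_val_fin_one, Pi.star_apply]
            linear_combination ρ 1 1 * this
        _ = _ := by rw [← Finset.sum_mul, hpc, one_mul]
  have hoff : ∀ ρ, ρ 0 1 = 0 → ρ 1 0 = 0 → Φ ρ = ρ := by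
    intro ρ h01 h10
    ext i j
    fin_cases i <;> fin_cases j
    · exact (hent ρ).1
    · simp [hΦ, Matrix.sum_apply, diagonal_conjTranspose, diagonal_mul, mul_diagonal, h01]
    · simp [hΦ, Matrix.sum_apply, diagonal_conjTranspose, diagonal_mul, mul_diagonal, h10]
    · exact (hent ρ).2
  have he0 : Φ (outer ![1, 0]) = outer ![1, 0] :=
    hoff _ (by simp [outer, vecMulVec_apply]) (by simp [outer, vecMulVec_apply])
  have he1 : Φ (outer ![0, 1]) = outer ![0, 1] :=
    hoff _ (by simp [outer, vecMulVec_apply]) (by simp [outer, vecMulVec_apply])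
  have hpsd : (Φ (outer φ)).PosSemidef := by
    rw [hΦ]
    refine posSemidef_sum _ fun i _ => ?_
    refine ((outer_psd φ).mul_mul_conjTranspose_same _).smul ?_
    exact_mod_cast (hp i).le
  have hf : ∀ z : ℂ, Real.sqrt (z * star z).re = ‖z‖ := by
    intro z
    rw [Complex.star_def, Complex.mul_conj, Complex.ofReal_re, Complex.normSq_eq_norm_sq,
      Real.sqrt_sq (norm_nonneg z)]
  have q0 : ∀ σ : Matrix (Fin 2) (Fin 2) ℂ, star ![(1:ℂ), 0] ⬝ᵥ (σ *ᵥ ![1, 0]) = σ 0 0 := by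
    intro σ; simp [dotProduct, mulVec, Fin.sum_univ_two]
  have q1 : ∀ σ : Matrix (Fin 2) (Fin 2) ℂ, star ![(0:ℂ), 1] ⬝ᵥ (σ *ᵥ ![0, 1]) = σ 1 1 := by
    intro σ; simp [dotProduct, mulVec, Fin.sum_univ_two]
  have u0 : star ![(1:ℂ), 0] ⬝ᵥ ![1, 0] = 1 := by simp [dotProduct, Fin.sum_univ_two]
  have u1 : star ![(0:ℂ), 1] ⬝ᵥ ![0, 1] = 1 := by simp [dotProduct, Fin.sum_univ_two]
  have o0 : outer φ 0 0 = φ 0 * star (φ 0) := rfl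
  have o1 : outer φ 1 1 = φ 1 * star (φ 1) := rfl
  have a1 : fid (outer ![1, 0]) (Φ (outer φ)) = ‖φ 0‖ := by
    rw [fid_outer_left _ hpsd, q0, (hent _).1, o0, hf]
  have a2 : fid (outer ![1, 0]) (outer φ) = ‖φ 0‖ := by
    rw [fid_outer_left _ (outer_psd φ), q0, o0, hf]
  have a3 : fid (outer ![0, 1]) (Φ (outer φ)) = ‖φ 1‖ := by
    rw [fid_outer_left _ hpsd, q1, (hent _).2, o1, hf]
  have a4 : fid (outer ![0, 1]) (outer φ) = ‖φ 1‖ := by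
    rw [fid_outer_left _ (outer_psd φ), q1, o1, hf]
  have b1 : fid (Φ (outer φ)) (outer ![1, 0]) = ‖φ 0‖ := by
    rw [fid_outer_right _ hpsd u0, q0, (hent _).1, o0, hf]
  have b2 : fid (outer φ) (outer ![1, 0]) = ‖φ 0‖ := by
    rw [fid_outer_right _ (outer_psd φ) u0, q0, o0, hf]
  have b3 : fid (Φ (outer φ)) (outer ![0, 1]) = ‖φ 1‖ := by
    rw [fid_outer_right _ hpsd u1, q1, (hent _).2, o1, hf]
  have b4 : fid (outer φ) (outer ![0, 1]) = ‖φ 1‖ := by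
    rw [fid_outer_right _ (outer_psd φ) u1, q1, o1, hf]
  have c : fid (Φ (outer φ)) (Φ (outer φ)) = fid (outer φ) (outer φ) := by
    rw [fid_self hpsd, fid_self (outer_psd φ), trace_fin_two, trace_fin_two,
      (hent _).1, (hent _).2]
  refine ⟨by rw [he0, a1], a2, by rw [he1, a3], a4, ?_, ?_⟩
  · rw [he0, he1, fid_outer_left _ (outer_psd _), q0]
    simp [outer, vecMulVec_apply]
  · rintro ρ (rfl | rfl | rfl) σ (rfl | rfl | rfl) <;>
      simp only [he0, he1, a1, a2, a3, a4, b1, b2, b3, b4, c]
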